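/- Let a_w, a_y, A_w, A_y, B̃_w, B̃_y be as follows: for reals K_w, K_y ≥ 0 and Ω_w, Ω_y > 0, set a_w = (1+K_w)/Ω_w, a_y = (1+K_y)/Ω_y, A_w = a_w e^{−K_w}, A_y = a_y e^{−K_y}, B̃_w(n) = ((K_w(1+K_w)/Ω_w)ⁿ/(n!)²)/a_w, B̃_y(k) = ((K_y(1+K_y)/Ω_y)^k/(k!)²)/a_y, and let 0 < a₂ < 1. Let Z be a nonnegative real-valued random variable whose tail satisfies P(Z > z) = A_w A_y ∑_{n=0}^∞ ∑_{k=0}^∞ B̃_w(n) B̃_y(k) Γ(n+1, a_w z) Γ(k+1, (a_y/a₂) z) for all z ≥ 0. Then for every real ρ > 0, the average achievable rate C₂ = (1/2)·E[log₂(1+ρZ)] is finite and equals (1/(2 ln 2)) · A_w A_y ∑_{n=0}^∞ ∑_{k=0}^∞ B̃_w(n) B̃_y(k) n! k! ∑_{i=0}^{n} ∑_{j=0}^{k} ((i+j)!/(i!j!)) (a_wⁱ (a_y/a₂)^j / ρ^{i+j}) e^{(a_w + a_y/a₂)/ρ} Γ(−(i+j), (a_w + a_y/a₂)/ρ). -/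

import Mathlib

open MeasureTheory Real Set Finset

/-- Upper incomplete Gamma function `Γ(n+1, x) = ∫_x^∞ tⁿ e^{-t} dt`. -/
noncomputable def uiGamma (n : ℕ) (x : ℝ) : ℝ :=
  ∫ t in Set.Ioi x, t ^ n * Real.exp (-t)

/-- Upper incomplete Gamma function of negative integer order:
    `Γ(-m, β) = ∫_β^∞ e^{-t} / t^{m+1} dt`. -/
noncomputable def uiGammaNeg (m : ℕ) (β : ℝ) : ℝ :=
  ∫ t in Set.Ioi β, Real.exp (-t) / t ^ (m + 1)

theorem integrableOn_pow_mul_exp_neg_mul (n : ℕ) {b : ℝ} (hb : 0 < b) :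
    IntegrableOn (fun t : ℝ => t ^ n * Real.exp (-(b * t))) (Set.Ioi 0) := by
  have h := integrableOn_rpow_mul_exp_neg_mul_rpow (p := 1) (s := n) (b := b)
    (by linarith [n.cast_nonneg (α := ℝ)]) one_pos hb
  simpa using h

theorem integral_pow_mul_exp_neg_mul (n : ℕ) {b : ℝ} (hb : 0 < b) :
    ∫ t in Set.Ioi (0 : ℝ), t ^ n * Real.exp (-(b * t)) = (n.factorial : ℝ) / b ^ (n + 1) := by
  have h := Real.integral_rpow_mul_exp_neg_mul_Ioi (a := n + 1) (r := b) (by positivity) hb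
  have h2 : (1 / b) ^ ((n : ℝ) + 1) = 1 / b ^ (n + 1) := by
    rw [← Nat.cast_add_one, Real.rpow_natCast, div_pow, one_pow]
  rw [h2, Real.Gamma_nat_eq_factorial] at h
  simp only [add_sub_cancel_right, Real.rpow_natCast] at h
  rw [h]
  ring

theorem uiGamma_succ (n : ℕ) {x : ℝ} (hx : 0 ≤ x) :
    uiGamma (n + 1) x = (n + 1) * uiGamma n x + x ^ (n + 1) * Real.exp (-x) := by
  have hInt (m : ℕ) : IntegrableOn (fun t : ℝ => t ^ m * Real.exp (-t)) (Set.Ioi x) := by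
    have h := integrableOn_pow_mul_exp_neg_mul m one_pos
    simp only [one_mul] at h
    exact h.mono_set (Set.Ioi_subset_Ioi hx)
  have hderiv (t : ℝ) (_ : t ∈ Set.Ici x) :
      HasDerivAt (fun t : ℝ => t ^ (n + 1) * Real.exp (-t))
        ((n + 1) * (t ^ n * Real.exp (-t)) - t ^ (n + 1) * Real.exp (-t)) t := by
    refine ((hasDerivAt_pow (n + 1) t).mul (hasDerivAt_neg t).exp).congr_deriv ?_
    rw [Nat.add_sub_cancel]
    push_cast
    ring
  have h := integral_Ioi_of_hasDerivAt_of_tendsto' hderiv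
    (((hInt n).const_mul _).sub (hInt (n + 1)))
    (Real.tendsto_pow_mul_exp_neg_atTop_nhds_zero (n + 1))
  rw [integral_sub ((hInt n).const_mul _) (hInt (n + 1)), integral_const_mul] at h
  unfold uiGamma
  linarith

theorem uiGamma_eq_sum (n : ℕ) {x : ℝ} (hx : 0 ≤ x) :
    uiGamma n x = (n.factorial : ℝ) *
      (Real.exp (-x) * ∑ i ∈ Finset.range (n + 1), x ^ i / (i.factorial : ℝ)) := by
  induction n with
  | zero => simpa [uiGamma] using integral_exp_neg_Ioi x
  | succ n ih =>
    rw [uiGamma_succ n hx, ih, Finset.sum_range_succ _ (n + 1), Nat.factorial_succ]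
    have : (n.factorial : ℝ) ≠ 0 := by positivity
    push_cast
    field_simp

theorem uiGamma_nonneg (n : ℕ) {x : ℝ} (hx : 0 ≤ x) : 0 ≤ uiGamma n x := by
  rw [uiGamma_eq_sum n hx]
  positivity

theorem uiGamma_le (n : ℕ) {x : ℝ} (hx : 0 ≤ x) :
    uiGamma n x ≤ (n.factorial : ℝ) * 2 ^ n * Real.exp (-(x / 2)) := by
  rw [uiGamma_eq_sum n hx, mul_assoc]
  refine mul_le_mul_of_nonneg_left ?_ (by positivity)
  have h : ∑ i ∈ Finset.range (n + 1), x ^ i / (i.factorial : ℝ) ≤ 2 ^ n * Real.exp (x / 2) := by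
    refine le_trans ?_ (mul_le_mul_of_nonneg_left
      (Real.sum_le_exp_of_nonneg (div_nonneg hx zero_le_two) (n + 1)) (by positivity))
    rw [Finset.mul_sum]
    refine Finset.sum_le_sum fun i hi => ?_
    have hi' : i ≤ n := Nat.lt_succ_iff.mp (Finset.mem_range.mp hi)
    have h2 : (2 : ℝ) ^ i ≤ 2 ^ n := pow_le_pow_right₀ one_le_two hi'
    rw [div_pow, ← mul_div_assoc]
    gcongr
    rw [mul_div_assoc', le_div_iff₀ (by positivity), mul_comm]
    gcongr
  calc Real.exp (-x) * ∑ i ∈ Finset.range (n + 1), x ^ i / (i.factorial : ℝ)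
      ≤ Real.exp (-x) * (2 ^ n * Real.exp (x / 2)) := by gcongr
    _ = 2 ^ n * Real.exp (-(x / 2)) := by
      rw [mul_left_comm, ← Real.exp_add]
      ring_nf

theorem uiGammaNeg_succ (m : ℕ) {β : ℝ} (hβ : 0 < β) :
    (m + 1) * uiGammaNeg (m + 1) β = Real.exp (-β) / β ^ (m + 1) - uiGammaNeg m β := by
  have hInt (k : ℕ) : IntegrableOn (fun t : ℝ => Real.exp (-t) / t ^ (k + 1)) (Set.Ioi β) := by
    have h : IntegrableOn (fun t : ℝ => Real.exp (-t) / β ^ (k + 1)) (Set.Ioi β) :=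
      (integrableOn_exp_neg_Ioi β).div_const _
    refine h.mono' (by fun_prop : Measurable _).aestronglyMeasurable ?_
    filter_upwards [ae_restrict_mem measurableSet_Ioi] with t ht
    have ht' : β < t := ht
    have : 0 < t := hβ.trans ht'
    rw [Real.norm_of_nonneg (by positivity)]
    gcongr
  have hderiv (t : ℝ) (ht : t ∈ Set.Ici β) :
      HasDerivAt (fun t : ℝ => Real.exp (-t) / t ^ (m + 1))
        (-(Real.exp (-t) / t ^ (m + 1)) - (m + 1) * (Real.exp (-t) / t ^ (m + 1 + 1))) t := by
    have ht0 : t ≠ 0 := (hβ.trans_le ht).ne'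
    refine ((hasDerivAt_neg t).exp.div (hasDerivAt_pow (m + 1) t)
      (pow_ne_zero _ ht0)).congr_deriv ?_
    rw [Nat.add_sub_cancel]
    push_cast
    field_simp
    ring
  have hlim : Filter.Tendsto (fun t : ℝ => Real.exp (-t) / t ^ (m + 1)) Filter.atTop (nhds 0) :=
    Real.tendsto_exp_neg_atTop_nhds_zero.div_atTop (Filter.tendsto_pow_atTop m.succ_ne_zero)
  have h := integral_Ioi_of_hasDerivAt_of_tendsto' hderiv
    ((hInt m).neg.sub ((hInt (m + 1)).const_mul _)) hlim
  have hsub := integral_sub (hInt m).neg ((hInt (m + 1)).const_mul ((m : ℝ) + 1))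
  simp only [Pi.neg_apply] at hsub
  rw [hsub, integral_const_mul, integral_neg] at h
  unfold uiGammaNeg
  linarith

theorem integral_comp_add_right_Ioi_zero (g : ℝ → ℝ) (c : ℝ) :
    ∫ x in Set.Ioi (0 : ℝ), g (x + c) = ∫ x in Set.Ioi c, g x := by
  have h := (measurePreserving_add_right volume c).setIntegral_preimage_emb
    (measurableEmbedding_addRight c) g (Set.Ioi c)
  simpa using h

theorem integrableOn_pow_mul_exp_mul_div (m : ℕ) {b ρ : ℝ} (hb : 0 < b) (hρ : 0 < ρ) :
    IntegrableOn (fun z : ℝ => z ^ m * Real.exp (-(b * z)) * (ρ / (1 + ρ * z))) (Set.Ioi 0) := by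
  refine ((integrableOn_pow_mul_exp_neg_mul m hb).mul_const ρ).mono' (by fun_prop) ?_
  filter_upwards [ae_restrict_mem measurableSet_Ioi] with z hz
  have hz' : 0 < z := hz
  rw [Real.norm_of_nonneg (by positivity)]
  gcongr
  exact div_le_self hρ.le (by nlinarith)

theorem integral_pow_mul_exp_mul_div (m : ℕ) {b ρ : ℝ} (hb : 0 < b) (hρ : 0 < ρ) :
    ∫ z in Set.Ioi (0 : ℝ), z ^ m * Real.exp (-(b * z)) * (ρ / (1 + ρ * z)) =
      (m.factorial : ℝ) / ρ ^ m * Real.exp (b / ρ) * uiGammaNeg m (b / ρ) := by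
  induction m with
  | zero =>
    have h1 : ∀ z ∈ Set.Ioi (0 : ℝ), z ^ 0 * Real.exp (-(b * z)) * (ρ / (1 + ρ * z)) =
        Real.exp (b / ρ) * b * (Real.exp (-(b * (z + 1 / ρ))) / (b * (z + 1 / ρ)) ^ (0 + 1)) := by
      intro z hz
      have hz' : 0 < z := hz
      have : -(b * z) = b / ρ + -(b * (z + 1 / ρ)) := by ring
      rw [this, Real.exp_add, show b * (z + 1 / ρ) = b * (1 + ρ * z) / ρ by field_simp; ring,
        zero_add, pow_one, pow_zero]
      field_simp
    rw [setIntegral_congr_fun measurableSet_Ioi h1, integral_const_mul,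
      integral_comp_add_right_Ioi_zero (fun z => Real.exp (-(b * z)) / (b * z) ^ (0 + 1)) (1 / ρ),
      integral_comp_mul_left_Ioi (fun z => Real.exp (-z) / z ^ (0 + 1)) _ hb]
    simp only [uiGammaNeg, smul_eq_mul, Nat.factorial_zero, Nat.cast_one, pow_zero]
    rw [mul_one_div]
    field_simp
  | succ m ih =>
    have h1 : ∀ z ∈ Set.Ioi (0 : ℝ),
        z ^ (m + 1) * Real.exp (-(b * z)) * (ρ / (1 + ρ * z)) =
        z ^ m * Real.exp (-(b * z)) -
          1 / ρ * (z ^ m * Real.exp (-(b * z)) * (ρ / (1 + ρ * z))) := by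
      intro z hz
      have hz' : 0 < z := hz
      field_simp
      ring
    rw [setIntegral_congr_fun measurableSet_Ioi h1,
      integral_sub (integrableOn_pow_mul_exp_neg_mul m hb)
        ((integrableOn_pow_mul_exp_mul_div m hb hρ).const_mul _),
      integral_const_mul, ih, integral_pow_mul_exp_neg_mul m hb]
    have h2 := uiGammaNeg_succ m (div_pos hb hρ)
    have h3 : uiGammaNeg m (b / ρ) = Real.exp (-(b / ρ)) / (b / ρ) ^ (m + 1) -
        (m + 1) * uiGammaNeg (m + 1) (b / ρ) := by linarith
    rw [h3, Nat.factorial_succ, Real.exp_neg]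
    generalize uiGammaNeg (m + 1) (b / ρ) = G
    have hE := Real.exp_pos (b / ρ)
    generalize Real.exp (b / ρ) = E at hE ⊢
    push_cast
    rw [div_pow]
    field_simp
    ring

theorem uiGamma_mul_uiGamma_eq_sum (n k : ℕ) {a d z : ℝ} (ha : 0 ≤ a) (hd : 0 ≤ d) (hz : 0 ≤ z) :
    uiGamma n (a * z) * uiGamma k (d * z) =
      (n.factorial : ℝ) * (k.factorial : ℝ) *
        ∑ i ∈ Finset.range (n + 1), ∑ j ∈ Finset.range (k + 1),
          a ^ i * d ^ j / ((i.factorial : ℝ) * (j.factorial : ℝ)) *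
            (z ^ (i + j) * Real.exp (-((a + d) * z))) := by
  have hexp : Real.exp (-((a + d) * z)) = Real.exp (-(a * z)) * Real.exp (-(d * z)) := by
    rw [← Real.exp_add]
    ring_nf
  rw [uiGamma_eq_sum n (by positivity), uiGamma_eq_sum k (by positivity)]
  rw [show ∀ p q r s t u : ℝ, p * (q * r) * (s * (t * u)) = p * s * (q * t * (r * u)) by
    intros; ring, Finset.sum_mul_sum, ← hexp, Finset.mul_sum]
  congr 1
  refine Finset.sum_congr rfl fun i _ => ?_
  rw [Finset.mul_sum]
  refine Finset.sum_congr rfl fun j _ => ?_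
  rw [mul_pow, mul_pow, pow_add]
  field_simp

theorem integral_uiGamma_mul_uiGamma (n k : ℕ) {a d ρ : ℝ} (ha : 0 < a) (hd : 0 < d)
    (hρ : 0 < ρ) :
    ∫ z in Set.Ioi (0 : ℝ), uiGamma n (a * z) * uiGamma k (d * z) * (ρ / (1 + ρ * z)) =
      (n.factorial : ℝ) * (k.factorial : ℝ) *
        ∑ i ∈ Finset.range (n + 1), ∑ j ∈ Finset.range (k + 1),
          ((Nat.factorial (i + j) : ℝ) / ((i.factorial : ℝ) * (j.factorial : ℝ))) *
            (a ^ i * d ^ j / ρ ^ (i + j)) * Real.exp ((a + d) / ρ) *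
            uiGammaNeg (i + j) ((a + d) / ρ) := by
  have h1 : ∀ z ∈ Set.Ioi (0 : ℝ),
      uiGamma n (a * z) * uiGamma k (d * z) * (ρ / (1 + ρ * z)) =
        (n.factorial : ℝ) * (k.factorial : ℝ) *
        ∑ i ∈ Finset.range (n + 1), ∑ j ∈ Finset.range (k + 1),
          a ^ i * d ^ j / ((i.factorial : ℝ) * (j.factorial : ℝ)) *
            (z ^ (i + j) * Real.exp (-((a + d) * z)) * (ρ / (1 + ρ * z))) := by
    intro z hz
    rw [uiGamma_mul_uiGamma_eq_sum n k ha.le hd.le (le_of_lt hz), mul_assoc, Finset.sum_mul]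
    simp only [Finset.sum_mul, mul_assoc]
  have hInt (i j : ℕ) := (integrableOn_pow_mul_exp_mul_div (i + j) (add_pos ha hd) hρ).const_mul
    (a ^ i * d ^ j / ((i.factorial : ℝ) * (j.factorial : ℝ)))
  rw [setIntegral_congr_fun measurableSet_Ioi h1, integral_const_mul,
    integral_finsetSum _ fun i _ => integrable_finsetSum _ fun j _ => hInt i j]
  congr 1
  refine Finset.sum_congr rfl fun i _ => ?_
  rw [integral_finsetSum _ fun j _ => hInt i j]
  refine Finset.sum_congr rfl fun j _ => ?_
  rw [integral_const_mul, integral_pow_mul_exp_mul_div (i + j) (add_pos ha hd) hρ]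
  field_simp

theorem uiGamma_mul_uiGamma_mul_div_le (n k : ℕ) {a d ρ z : ℝ} (ha : 0 < a) (hd : 0 < d)
    (hρ : 0 < ρ) (hz : 0 ≤ z) :
    uiGamma n (a * z) * uiGamma k (d * z) * (ρ / (1 + ρ * z)) ≤
      ((n.factorial : ℝ) * 2 ^ n) * ((k.factorial : ℝ) * 2 ^ k) *
        (Real.exp (-((a + d) / 2 * z)) * ρ) := by
  have h1 := uiGamma_le n (mul_nonneg ha.le hz)
  have h2 := uiGamma_le k (mul_nonneg hd.le hz)
  have h3 : ρ / (1 + ρ * z) ≤ ρ := div_le_self hρ.le (by nlinarith)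
  have h4 : Real.exp (-((a + d) / 2 * z)) =
      Real.exp (-(a * z / 2)) * Real.exp (-(d * z / 2)) := by
    rw [← Real.exp_add]
    ring_nf
  calc _ ≤ ((n.factorial : ℝ) * 2 ^ n * Real.exp (-(a * z / 2))) *
        ((k.factorial : ℝ) * 2 ^ k * Real.exp (-(d * z / 2))) * ρ := by
        gcongr
        exact uiGamma_nonneg k (by positivity)
    _ = _ := by rw [h4]; ring

theorem integrableOn_uiGamma_mul_uiGamma (n k : ℕ) {a d ρ : ℝ} (ha : 0 < a) (hd : 0 < d)
    (hρ : 0 < ρ) :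
    IntegrableOn (fun z : ℝ => uiGamma n (a * z) * uiGamma k (d * z) * (ρ / (1 + ρ * z)))
      (Set.Ioi 0) := by
  have hInt (i j : ℕ) := (integrableOn_pow_mul_exp_mul_div (i + j) (add_pos ha hd) hρ).const_mul
    (a ^ i * d ^ j / ((i.factorial : ℝ) * (j.factorial : ℝ)))
  refine IntegrableOn.congr_fun ((integrable_finsetSum (Finset.range (n + 1)) fun i _ =>
    integrable_finsetSum (Finset.range (k + 1)) fun j _ => hInt i j).const_mul
      ((n.factorial : ℝ) * (k.factorial : ℝ))) (fun z hz => ?_) measurableSet_Ioi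
  rw [uiGamma_mul_uiGamma_eq_sum n k ha.le hd.le (le_of_lt hz), mul_assoc _ _ (ρ / _),
    Finset.sum_mul]
  simp only [Finset.sum_mul, mul_assoc]

theorem lintegral_log_one_add_mul {Ω' : Type*} [MeasurableSpace Ω'] (μ : Measure Ω')
    {Z : Ω' → ℝ} (hZ : Measurable Z) (hZnonneg : ∀ ω, 0 ≤ Z ω) {ρ : ℝ} (hρ : 0 < ρ) :
    ∫⁻ ω, ENNReal.ofReal (Real.log (1 + ρ * Z ω)) ∂μ =
      ∫⁻ z in Set.Ioi 0, μ {ω | z < Z ω} * ENNReal.ofReal (ρ / (1 + ρ * z)) := by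
  have hcont (t : ℝ) (ht : 0 ≤ t) :
      IntervalIntegrable (fun z => ρ / (1 + ρ * z)) volume 0 t := by
    refine ContinuousOn.intervalIntegrable fun z hz => ?_
    rw [Set.uIcc_of_le ht] at hz
    have : 1 + ρ * z ≠ 0 := by nlinarith [mul_nonneg hρ.le hz.1]
    exact ContinuousAt.continuousWithinAt (by fun_prop (disch := assumption))
  rw [← lintegral_comp_eq_lintegral_meas_lt_mul μ (ae_of_all _ hZnonneg) hZ.aemeasurable
    (fun t ht => hcont t ht.le)]
  · refine lintegral_congr fun ω => ?_
    congr 1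
    rw [intervalIntegral.integral_eq_sub_of_hasDerivAt (f := fun z => Real.log (1 + ρ * z)) _
      (hcont _ (hZnonneg ω))]
    · simp
    · intro z hz
      rw [Set.uIcc_of_le (hZnonneg ω)] at hz
      have : 1 + ρ * z ≠ 0 := by nlinarith [mul_nonneg hρ.le hz.1]
      simpa using (((hasDerivAt_id z).const_mul ρ).const_add 1).log this
  · filter_upwards [ae_restrict_mem measurableSet_Ioi] with z hz
    have hz' : 0 < z := hz
    positivity

theorem summable_mul_uiGamma_mul_uiGamma {c : ℕ × ℕ → ℝ} {a d z : ℝ} (hc : ∀ p, 0 ≤ c p)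
    (hsum : Summable fun p : ℕ × ℕ =>
      c p * (((p.1.factorial : ℝ) * 2 ^ p.1) * ((p.2.factorial : ℝ) * 2 ^ p.2)))
    (ha : 0 ≤ a) (hd : 0 ≤ d) (hz : 0 ≤ z) :
    Summable fun p : ℕ × ℕ => c p * (uiGamma p.1 (a * z) * uiGamma p.2 (d * z)) := by
  have hle (n : ℕ) {x : ℝ} (hx : 0 ≤ x) : uiGamma n x ≤ (n.factorial : ℝ) * 2 ^ n :=
    (uiGamma_le n hx).trans (mul_le_of_le_one_right (by positivity)
      (Real.exp_le_one_iff.mpr (by linarith)))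
  have haz : 0 ≤ a * z := by positivity
  have hdz : 0 ≤ d * z := by positivity
  refine hsum.of_nonneg_of_le (fun p => mul_nonneg (hc p)
    (mul_nonneg (uiGamma_nonneg _ haz) (uiGamma_nonneg _ hdz))) fun p => ?_
  exact mul_le_mul_of_nonneg_left
    (mul_le_mul (hle _ haz) (hle _ hdz) (uiGamma_nonneg _ hdz) (by positivity)) (hc p)

theorem summable_mul_integral_uiGamma_mul_uiGamma {c : ℕ × ℕ → ℝ} {a d ρ : ℝ}
    (hc : ∀ p, 0 ≤ c p)
    (hsum : Summable fun p : ℕ × ℕ =>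
      c p * (((p.1.factorial : ℝ) * 2 ^ p.1) * ((p.2.factorial : ℝ) * 2 ^ p.2)))
    (ha : 0 < a) (hd : 0 < d) (hρ : 0 < ρ) :
    Summable fun p : ℕ × ℕ => c p * ∫ z in Set.Ioi (0 : ℝ),
      uiGamma p.1 (a * z) * uiGamma p.2 (d * z) * (ρ / (1 + ρ * z)) := by
  have hInt : IntegrableOn (fun z : ℝ => Real.exp (-((a + d) / 2 * z)) * ρ) (Set.Ioi 0) := by
    have h := integrableOn_pow_mul_exp_neg_mul 0 (half_pos (add_pos ha hd))
    simp only [pow_zero, one_mul] at h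
    exact h.mul_const ρ
  refine Summable.of_nonneg_of_le
    (fun p => mul_nonneg (hc p) (setIntegral_nonneg measurableSet_Ioi fun z hz => ?_)) (fun p => ?_)
    (hsum.mul_right (∫ z in Set.Ioi (0 : ℝ), Real.exp (-((a + d) / 2 * z)) * ρ))
  · have hz' : 0 < z := hz
    have h1 := uiGamma_nonneg p.1 (mul_pos ha hz').le
    have h2 := uiGamma_nonneg p.2 (mul_pos hd hz').le
    positivity
  · rw [mul_assoc, ← integral_const_mul (_ * _)]
    refine mul_le_mul_of_nonneg_left (setIntegral_mono_on
      (integrableOn_uiGamma_mul_uiGamma _ _ ha hd hρ) (hInt.const_mul _) measurableSet_Ioi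
      fun z hz => uiGamma_mul_uiGamma_mul_div_le _ _ ha hd hρ (le_of_lt hz)) (hc p)

theorem lintegral_tsum_uiGamma_mul_uiGamma {c : ℕ × ℕ → ℝ} {a d ρ : ℝ} (hc : ∀ p, 0 ≤ c p)
    (hsum : Summable fun p : ℕ × ℕ =>
      c p * (((p.1.factorial : ℝ) * 2 ^ p.1) * ((p.2.factorial : ℝ) * 2 ^ p.2)))
    (ha : 0 < a) (hd : 0 < d) (hρ : 0 < ρ) :
    ∫⁻ z in Set.Ioi (0 : ℝ),
        ENNReal.ofReal (∑' p : ℕ × ℕ, c p * (uiGamma p.1 (a * z) * uiGamma p.2 (d * z))) *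
          ENNReal.ofReal (ρ / (1 + ρ * z)) =
      ENNReal.ofReal (∑' p : ℕ × ℕ, c p * ∫ z in Set.Ioi (0 : ℝ),
        uiGamma p.1 (a * z) * uiGamma p.2 (d * z) * (ρ / (1 + ρ * z))) := by
  have hnn (p : ℕ × ℕ) {z : ℝ} (hz : z ∈ Set.Ioi (0 : ℝ)) :
      0 ≤ c p * (uiGamma p.1 (a * z) * uiGamma p.2 (d * z)) :=
    mul_nonneg (hc p) (mul_nonneg (uiGamma_nonneg _ (mul_pos ha hz).le)
      (uiGamma_nonneg _ (mul_pos hd hz).le))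
  have hnn' (p : ℕ × ℕ) {z : ℝ} (hz : z ∈ Set.Ioi (0 : ℝ)) :
      0 ≤ c p * (uiGamma p.1 (a * z) * uiGamma p.2 (d * z) * (ρ / (1 + ρ * z))) := by
    have hz' : 0 < z := hz
    rw [← mul_assoc]
    exact mul_nonneg (hnn p hz) (by positivity)
  have hInt (p : ℕ × ℕ) :=
    (integrableOn_uiGamma_mul_uiGamma p.1 p.2 ha hd hρ).const_mul (c p)
  have hpt : ∀ z ∈ Set.Ioi (0 : ℝ),
      ENNReal.ofReal (∑' p : ℕ × ℕ, c p * (uiGamma p.1 (a * z) * uiGamma p.2 (d * z))) *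
          ENNReal.ofReal (ρ / (1 + ρ * z)) =
        ∑' p : ℕ × ℕ, ENNReal.ofReal
          (c p * (uiGamma p.1 (a * z) * uiGamma p.2 (d * z) * (ρ / (1 + ρ * z)))) := by
    intro z hz
    rw [ENNReal.ofReal_tsum_of_nonneg (fun p => hnn p hz)
      (summable_mul_uiGamma_mul_uiGamma hc hsum ha.le hd.le (le_of_lt hz)),
      ← ENNReal.tsum_mul_right]
    refine tsum_congr fun p => ?_
    rw [← ENNReal.ofReal_mul (hnn p hz), mul_assoc]
  rw [setLIntegral_congr_fun measurableSet_Ioi hpt,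
    lintegral_tsum fun p => (hInt p).aestronglyMeasurable.aemeasurable.ennreal_ofReal,
    ENNReal.ofReal_tsum_of_nonneg _ (summable_mul_integral_uiGamma_mul_uiGamma hc hsum ha hd hρ)]
  · refine tsum_congr fun p => ?_
    rw [← integral_const_mul, ofReal_integral_eq_lintegral_ofReal (hInt p)]
    filter_upwards [ae_restrict_mem measurableSet_Ioi] with z hz using hnn' p hz
  · intro p
    rw [← integral_const_mul]
    exact setIntegral_nonneg measurableSet_Ioi fun z hz => hnn' p hz

theorem summable_pow_div_factorial_sq_mul (x a : ℝ) :
    Summable fun n : ℕ =>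
      x ^ n / (n.factorial : ℝ) ^ 2 / a * ((n.factorial : ℝ) * 2 ^ n) := by
  refine ((Real.summable_pow_div_factorial (2 * x)).div_const a).congr fun n => ?_
  rw [mul_pow]
  field_simp

/-- The average achievable rate of symbol `s₂` in the NOMA-based cooperative relaying
    system over Rician fading: if the nonnegative random variable `Z` has the tail
    `P(Z > z) = A_w A_y ∑_{n,k} B̃_w(n) B̃_y(k) Γ(n+1, a_w z) Γ(k+1, (a_y/a₂) z)`, then
    `C₂ = (1/2)·E[log₂(1+ρZ)]` is finite and equals
    `(1/(2 ln 2)) A_w A_y ∑_{n,k} B̃_w(n) B̃_y(k) n! k! ∑_{i=0}^{n} ∑_{j=0}^{k}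
      ((i+j)!/(i!j!)) (a_wⁱ (a_y/a₂)^j / ρ^{i+j}) e^{(a_w+a_y/a₂)/ρ}
      Γ(-(i+j), (a_w+a_y/a₂)/ρ)`. -/
theorem achievable_rate_s2 {Ω' : Type*} [MeasurableSpace Ω'] (μ : Measure Ω')
    [IsProbabilityMeasure μ] (Z : Ω' → ℝ) (hZ : Measurable Z) (hZnonneg : ∀ ω, 0 ≤ Z ω)
    (Kw Ky Ωw Ωy ρ a2 : ℝ)
    (hKw : 0 ≤ Kw) (hKy : 0 ≤ Ky) (hΩw : 0 < Ωw) (hΩy : 0 < Ωy)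
    (hρ : 0 < ρ) (ha2 : 0 < a2) (ha2' : a2 < 1)
    (aw ay Aw Ay : ℝ) (Bw By : ℕ → ℝ)
    (haw : aw = (1 + Kw) / Ωw) (hay : ay = (1 + Ky) / Ωy)
    (hAw : Aw = aw * Real.exp (-Kw)) (hAy : Ay = ay * Real.exp (-Ky))
    (hBw : ∀ n, Bw n = ((Kw * (1 + Kw) / Ωw) ^ n / ((Nat.factorial n : ℝ)) ^ 2) / aw)
    (hBy : ∀ k, By k = ((Ky * (1 + Ky) / Ωy) ^ k / ((Nat.factorial k : ℝ)) ^ 2) / ay)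
    (htail : ∀ z : ℝ, 0 ≤ z →
      (μ {ω | z < Z ω}).toReal
        = Aw * Ay * ∑' n : ℕ, ∑' k : ℕ,
            Bw n * By k * uiGamma n (aw * z) * uiGamma k ((ay / a2) * z)) :
    Integrable (fun ω => Real.logb 2 (1 + ρ * Z ω)) μ ∧
    (1 / 2) * ∫ ω, Real.logb 2 (1 + ρ * Z ω) ∂μ
      = (1 / (2 * Real.log 2)) * (Aw * Ay * ∑' n : ℕ, ∑' k : ℕ,
          Bw n * By k * (Nat.factorial n : ℝ) * (Nat.factorial k : ℝ) *
          ∑ i ∈ Finset.range (n + 1), ∑ j ∈ Finset.range (k + 1),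
            ((Nat.factorial (i + j) : ℝ) / ((Nat.factorial i : ℝ) * (Nat.factorial j : ℝ))) *
            (aw ^ i * (ay / a2) ^ j / ρ ^ (i + j)) * Real.exp ((aw + ay / a2) / ρ) *
            uiGammaNeg (i + j) ((aw + ay / a2) / ρ)) := by
  have haw0 : 0 < aw := by rw [haw]; positivity
  have hay0 : 0 < ay := by rw [hay]; positivity
  have hAw0 : 0 ≤ Aw := by rw [hAw]; positivity
  have hAy0 : 0 ≤ Ay := by rw [hAy]; positivity
  have hd0 : 0 < ay / a2 := div_pos hay0 ha2
  have hBw0 (n : ℕ) : 0 ≤ Bw n := by rw [hBw]; positivity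
  have hBy0 (k : ℕ) : 0 ≤ By k := by rw [hBy]; positivity
  generalize ay / a2 = d at *
  set c : ℕ × ℕ → ℝ := fun p => Aw * Ay * (Bw p.1 * By p.2) with hc_def
  have hc (p : ℕ × ℕ) : 0 ≤ c p :=
    mul_nonneg (mul_nonneg hAw0 hAy0) (mul_nonneg (hBw0 _) (hBy0 _))
  have hsum : Summable fun p : ℕ × ℕ =>
      c p * (((p.1.factorial : ℝ) * 2 ^ p.1) * ((p.2.factorial : ℝ) * 2 ^ p.2)) := by
    have hw : Summable fun n : ℕ => Bw n * ((n.factorial : ℝ) * 2 ^ n) := by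
      simp only [hBw]
      exact summable_pow_div_factorial_sq_mul _ _
    have hy : Summable fun k : ℕ => By k * ((k.factorial : ℝ) * 2 ^ k) := by
      simp only [hBy]
      exact summable_pow_div_factorial_sq_mul _ _
    refine ((hw.mul_of_nonneg hy (fun n => mul_nonneg (hBw0 n) (by positivity))
      (fun k => mul_nonneg (hBy0 k) (by positivity))).mul_left (Aw * Ay)).congr fun p => ?_
    simp only [hc_def]
    ring
  have htsum (X : ℕ × ℕ → ℝ) (hX : Summable fun p => c p * X p) :
      ∑' p, c p * X p = Aw * Ay * ∑' n : ℕ, ∑' k : ℕ, Bw n * By k * X (n, k) := by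
    rw [hX.tsum_prod]
    simp only [hc_def, mul_assoc, tsum_mul_left]
  have hmeas (z : ℝ) (hz : z ∈ Set.Ioi (0 : ℝ)) : μ {ω | z < Z ω} =
      ENNReal.ofReal (∑' p : ℕ × ℕ, c p * (uiGamma p.1 (aw * z) * uiGamma p.2 (d * z))) := by
    rw [htsum _ (summable_mul_uiGamma_mul_uiGamma hc hsum haw0.le hd0.le (le_of_lt hz)),
      ← ENNReal.ofReal_toReal (measure_ne_top μ {ω | z < Z ω}), htail z (le_of_lt hz)]
    simp only [mul_assoc]
  have hlint : ∫⁻ ω, ENNReal.ofReal (Real.log (1 + ρ * Z ω)) ∂μ =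
      ENNReal.ofReal (∑' p : ℕ × ℕ, c p * ∫ z in Set.Ioi (0 : ℝ),
        uiGamma p.1 (aw * z) * uiGamma p.2 (d * z) * (ρ / (1 + ρ * z))) := by
    rw [lintegral_log_one_add_mul μ hZ hZnonneg hρ,
      ← lintegral_tsum_uiGamma_mul_uiGamma hc hsum haw0 hd0 hρ]
    refine setLIntegral_congr_fun measurableSet_Ioi fun z hz => ?_
    simp only [hmeas z hz]
  have hlog0 : 0 ≤ᵐ[μ] fun ω => Real.log (1 + ρ * Z ω) :=
    ae_of_all _ fun ω => Real.log_nonneg (by nlinarith [mul_nonneg hρ.le (hZnonneg ω)])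
  have hlogm : AEStronglyMeasurable (fun ω => Real.log (1 + ρ * Z ω)) μ :=
    (by fun_prop : Measurable fun ω => Real.log (1 + ρ * Z ω)).aestronglyMeasurable
  have hInt : Integrable (fun ω => Real.log (1 + ρ * Z ω)) μ := by
    refine ⟨hlogm, ?_⟩
    rw [hasFiniteIntegral_iff_ofReal hlog0, hlint]
    exact ENNReal.ofReal_lt_top
  refine ⟨hInt.div_const (Real.log 2), ?_⟩
  have hS := summable_mul_integral_uiGamma_mul_uiGamma hc hsum haw0 hd0 hρ
  have hval : ∫ ω, Real.log (1 + ρ * Z ω) ∂μ =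
      ∑' p : ℕ × ℕ, c p * ∫ z in Set.Ioi (0 : ℝ),
        uiGamma p.1 (aw * z) * uiGamma p.2 (d * z) * (ρ / (1 + ρ * z)) := by
    rw [integral_eq_lintegral_of_nonneg_ae hlog0 hlogm, hlint, ENNReal.toReal_ofReal]
    refine tsum_nonneg fun p => mul_nonneg (hc p) (setIntegral_nonneg measurableSet_Ioi
      fun z hz => ?_)
    have hz' : 0 < z := hz
    have h1 := uiGamma_nonneg p.1 (mul_pos haw0 hz').le
    have h2 := uiGamma_nonneg p.2 (mul_pos hd0 hz').le
    positivity
  simp only [Real.logb]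
  rw [integral_div, hval, htsum _ hS]
  simp only [integral_uiGamma_mul_uiGamma _ _ haw0 hd0 hρ, ← mul_assoc]
  ring
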